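/- Let k be an algebraically closed field with char k ≠ 2, V = k⁷, γ₀ the standard trilinear form γ₀ = f*₁₄₇ + f*₂₄₆ + f*₃₄₅ − f*₁₅₆ − f*₂₃₇, and SG(γ₀) = {g ∈ SL(V) : γ₀(g·u, g·v, g·w) = γ₀(u, v, w) for all u, v, w}. Then SG(γ₀) acts irreducibly on V: the only subspaces W ⊆ V with g·W ⊆ W for all g ∈ SG(γ₀) are W = 0 and W = V. -/

import Mathlib

open Module

/-- The alternating trilinear form `f*ₚqᵣ` on `k⁷`. -/
def tripleDet {k : Type*} [Field k] (p q r : Fin 7) (u v w : Fin 7 → k) : k :=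
  Matrix.det !![u p, u q, u r; v p, v q, v r; w p, w q, w r]

/-- The standard trilinear form `γ₀ = f*₁₄₇ + f*₂₄₆ + f*₃₄₅ − f*₁₅₆ − f*₂₃₇` on `k⁷`. -/
def gammaStd {k : Type*} [Field k] (u v w : Fin 7 → k) : k :=
  tripleDet 0 3 6 u v w + tripleDet 1 3 5 u v w + tripleDet 2 3 4 u v w
    - tripleDet 0 4 5 u v w - tripleDet 1 2 6 u v w

open scoped Matrix

section Coordinates

variable {k ι : Type*} [Field k]

/-- A subspace stable under pointwise multiplication by a vector `d` with distinct entries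
contains the coordinate components of its elements. -/
lemma Submodule.single_mem_of_mul_mem [Fintype ι] [DecidableEq ι] {W : Submodule k (ι → k)}
    {d : ι → k} (hd : Function.Injective d) (hW : ∀ v ∈ W, d * v ∈ W)
    {v : ι → k} (hv : v ∈ W) {i : ι} (hi : v i ≠ 0) : Pi.single i 1 ∈ W := by
  have key : ∀ s : Finset ι, (fun l => (∏ j ∈ s, (d l - d j)) * v l) ∈ W := by
    intro s
    induction s using Finset.induction_on with
    | empty => simpa using hv
    | insert a s ha ih =>
      convert W.sub_mem (hW _ ih) (W.smul_mem (d a) ih) using 1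
      ext l
      simp only [Finset.prod_insert ha, Pi.sub_apply, Pi.mul_apply, Pi.smul_apply, smul_eq_mul]
      ring
  have hc : (∏ j ∈ Finset.univ.erase i, (d i - d j)) * v i ≠ 0 := by
    refine mul_ne_zero (Finset.prod_ne_zero_iff.2 fun j hj => ?_) hi
    exact sub_ne_zero.2 (hd.ne (Finset.ne_of_mem_erase hj).symm)
  convert W.smul_mem ((∏ j ∈ Finset.univ.erase i, (d i - d j)) * v i)⁻¹
    (key (Finset.univ.erase i)) using 1
  ext l
  rw [Pi.smul_apply, smul_eq_mul]
  rcases eq_or_ne l i with rfl | hl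
  · rw [Pi.single_eq_same, inv_mul_cancel₀ hc]
  · have hz : ∏ j ∈ Finset.univ.erase i, (d l - d j) = 0 :=
      Finset.prod_eq_zero (i := l) (by simp [hl]) (sub_self _)
    rw [Pi.single_eq_of_ne hl, hz, zero_mul, mul_zero]

lemma Submodule.eq_top_of_single_mem [Fintype ι] [DecidableEq ι] {W : Submodule k (ι → k)}
    (h : ∀ i, Pi.single i 1 ∈ W) : W = ⊤ := by
  rw [eq_top_iff, ← (Pi.basisFun k ι).span_eq, Submodule.span_le]
  rintro _ ⟨i, rfl⟩
  simpa using h i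

/-- An infinite field contains an element with any given positive number of initial powers
different from one. -/
lemma exists_ne_zero_forall_pow_ne_one [Infinite k] (n : ℕ) :
    ∃ t : k, t ≠ 0 ∧ ∀ m, 0 < m → m ≤ n → t ^ m ≠ 1 := by
  classical
  have hp : (Polynomial.X * ∏ m ∈ Finset.Icc 1 n, (Polynomial.X ^ m - 1) : Polynomial k) ≠ 0 := by
    refine mul_ne_zero Polynomial.X_ne_zero (Finset.prod_ne_zero_iff.2 fun m hm => ?_)
    exact Polynomial.X_pow_sub_C_ne_zero (Finset.mem_Icc.1 hm).1 1
  obtain ⟨t, ht⟩ : ∃ t : k, Polynomial.eval t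
      (Polynomial.X * ∏ m ∈ Finset.Icc 1 n, (Polynomial.X ^ m - 1)) ≠ 0 := by
    by_contra! h
    exact hp (Polynomial.funext fun t => by simpa using h t)
  rw [Polynomial.eval_mul, Polynomial.eval_prod] at ht
  refine ⟨t, by simpa using left_ne_zero_of_mul ht, fun m h0 hm h1 => ?_⟩
  refine Finset.prod_ne_zero_iff.1 (right_ne_zero_of_mul ht) m (Finset.mem_Icc.2 ⟨h0, hm⟩) ?_
  simp [h1]

end Coordinates

section Isometries

variable {k : Type*} [Field k]

/-- The diagonal entries of a regular one-parameter subgroup of the torus of `SG(γ₀)`. -/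
def gammaTorus (t : k) : Fin 7 → k :=
  ![t ^ 3, t, t ^ 2, 1, (t ^ 2)⁻¹, t⁻¹, (t ^ 3)⁻¹]

/-- The root element `f₆ ↦ f₆ + f₄ + f₂`, `f₄ ↦ f₄ + 2 • f₂`, `f₇ ↦ f₇ - f₅`, `f₃ ↦ f₃ - f₁`. -/
def gammaRootTwo : Matrix (Fin 7) (Fin 7) k :=
  !![1, 0, -1, 0, 0, 0, 0;
     0, 1, 0, 2, 0, 1, 0;
     0, 0, 1, 0, 0, 0, 0;
     0, 0, 0, 1, 0, 1, 0;
     0, 0, 0, 0, 1, 0, -1;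
     0, 0, 0, 0, 0, 1, 0;
     0, 0, 0, 0, 0, 0, 1]

/-- The root element `f₅ ↦ f₅ + f₄ + f₃`, `f₄ ↦ f₄ + 2 • f₃`, `f₇ ↦ f₇ + f₆`, `f₂ ↦ f₂ + f₁`. -/
def gammaRootThree : Matrix (Fin 7) (Fin 7) k :=
  !![1, 1, 0, 0, 0, 0, 0;
     0, 1, 0, 0, 0, 0, 0;
     0, 0, 1, 2, 1, 0, 0;
     0, 0, 0, 1, 1, 0, 0;
     0, 0, 0, 0, 1, 0, 0;
     0, 0, 0, 0, 0, 1, 1;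
     0, 0, 0, 0, 0, 0, 1]

/-- The longest Weyl group element `fᵢ ↦ -f₈₋ᵢ`. -/
def gammaWeyl : Matrix (Fin 7) (Fin 7) k :=
  !![0, 0, 0, 0, 0, 0, -1;
     0, 0, 0, 0, 0, -1, 0;
     0, 0, 0, 0, -1, 0, 0;
     0, 0, 0, -1, 0, 0, 0;
     0, 0, -1, 0, 0, 0, 0;
     0, -1, 0, 0, 0, 0, 0;
     -1, 0, 0, 0, 0, 0, 0]

lemma gammaTorus_injective {t : k} (ht : t ≠ 0) (h : ∀ m, 0 < m → m ≤ 6 → t ^ m ≠ 1) :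
    Function.Injective (gammaTorus t) := by
  have e : ∀ i, gammaTorus t i * t ^ 3 = t ^ (![6, 4, 5, 3, 1, 2, 0] : Fin 7 → ℕ) i := by
    intro i
    fin_cases i <;> simp [gammaTorus] <;> field_simp
  have aux : ∀ a b : ℕ, a ≤ 6 → b < a → t ^ a ≠ t ^ b := by
    intro a b ha hb hab
    refine h (a - b) (by omega) (by omega) ?_
    rw [← Nat.sub_add_cancel hb.le, pow_add] at hab
    exact (mul_eq_right₀ (pow_ne_zero b ht)).1 hab
  have hle : ∀ i, (![6, 4, 5, 3, 1, 2, 0] : Fin 7 → ℕ) i ≤ 6 := by decide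
  have hinj : Function.Injective (![6, 4, 5, 3, 1, 2, 0] : Fin 7 → ℕ) := by decide
  intro i j hij
  have hpow := (e i).symm.trans ((congrArg (· * t ^ 3) hij).trans (e j))
  refine hinj ?_
  by_contra hne
  rcases Nat.lt_or_gt_of_ne hne with hlt | hlt
  · exact aux _ _ (hle j) hlt hpow.symm
  · exact aux _ _ (hle i) hlt hpow

lemma det_diagonal_gammaTorus {t : k} (ht : t ≠ 0) :
    (Matrix.diagonal (gammaTorus t)).det = 1 := by
  rw [Matrix.det_diagonal]
  simp [gammaTorus, Fin.prod_univ_succ]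
  field_simp

lemma det_gammaRootTwo : (gammaRootTwo : Matrix (Fin 7) (Fin 7) k).det = 1 := by
  rw [Matrix.det_of_isUpperTriangular]
  · simp [gammaRootTwo, Fin.prod_univ_succ]
  · intro i j hij
    fin_cases i <;> fin_cases j <;> first | rfl | simp at hij

lemma det_gammaRootThree : (gammaRootThree : Matrix (Fin 7) (Fin 7) k).det = 1 := by
  rw [Matrix.det_of_isUpperTriangular]
  · simp [gammaRootThree, Fin.prod_univ_succ]
  · intro i j hij
    fin_cases i <;> fin_cases j <;> first | rfl | simp at hij

lemma det_gammaWeyl : (gammaWeyl : Matrix (Fin 7) (Fin 7) k).det = 1 := by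
  have h : (gammaWeyl : Matrix (Fin 7) (Fin 7) k) = -(1 : Matrix (Fin 7) (Fin 7) k).submatrix
      Fin.revPerm id := by
    ext i j
    fin_cases i <;> fin_cases j <;> simp [gammaWeyl, Matrix.one_apply, Fin.ext_iff]
  have hs : Equiv.Perm.sign (Fin.revPerm : Equiv.Perm (Fin 7)) = -1 := by decide
  rw [h, Matrix.det_neg, Matrix.det_permute, hs, Matrix.det_one, Fintype.card_fin]
  norm_num

lemma gammaStd_gammaTorus {t : k} (ht : t ≠ 0) (u v w : Fin 7 → k) :
    gammaStd (Matrix.diagonal (gammaTorus t) *ᵥ u) (Matrix.diagonal (gammaTorus t) *ᵥ v)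
      (Matrix.diagonal (gammaTorus t) *ᵥ w) = gammaStd u v w := by
  simp [gammaStd, tripleDet, Matrix.det_fin_three, Matrix.mulVec_diagonal, gammaTorus]
  field_simp

lemma gammaStd_gammaRootTwo (u v w : Fin 7 → k) :
    gammaStd (gammaRootTwo *ᵥ u) (gammaRootTwo *ᵥ v) (gammaRootTwo *ᵥ w) = gammaStd u v w := by
  simp [gammaStd, tripleDet, Matrix.det_fin_three, gammaRootTwo, Matrix.mulVec, dotProduct,
    Fin.sum_univ_succ]
  ring

lemma gammaStd_gammaRootThree (u v w : Fin 7 → k) :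
    gammaStd (gammaRootThree *ᵥ u) (gammaRootThree *ᵥ v) (gammaRootThree *ᵥ w) = gammaStd u v w := by
  simp [gammaStd, tripleDet, Matrix.det_fin_three, gammaRootThree, Matrix.mulVec, dotProduct,
    Fin.sum_univ_succ]
  ring

lemma gammaStd_gammaWeyl (u v w : Fin 7 → k) :
    gammaStd (gammaWeyl *ᵥ u) (gammaWeyl *ᵥ v) (gammaWeyl *ᵥ w) = gammaStd u v w := by
  simp [gammaStd, tripleDet, Matrix.det_fin_three, gammaWeyl, Matrix.mulVec, dotProduct,
    Fin.sum_univ_succ]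
  ring

end Isometries

/-- `SG(γ₀)` acts irreducibly on `k⁷`: any subspace invariant under all
determinant-one linear automorphisms preserving `γ₀` is `0` or all of `k⁷`. -/
theorem sg_gamma_irreducible
    {k : Type*} [Field k] [IsAlgClosed k] (hchar : (2 : k) ≠ 0)
    (W : Submodule k (Fin 7 → k))
    (hW : ∀ g : (Fin 7 → k) →ₗ[k] (Fin 7 → k), Function.Bijective g →
      LinearMap.det g = 1 →
      (∀ u v w : Fin 7 → k, gammaStd (g u) (g v) (g w) = gammaStd u v w) →
      ∀ v ∈ W, g v ∈ W) :
    W = ⊥ ∨ W = ⊤ := by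
  have hM : ∀ A : Matrix (Fin 7) (Fin 7) k, A.det = 1 →
      (∀ u v w, gammaStd (A *ᵥ u) (A *ᵥ v) (A *ᵥ w) = gammaStd u v w) →
      ∀ v ∈ W, A *ᵥ v ∈ W := by
    intro A hA hγ v hv
    have hu : IsUnit A := (Matrix.isUnit_iff_isUnit_det A).2 (hA ▸ isUnit_one)
    exact hW (Matrix.toLin' A)
      ⟨Matrix.mulVec_injective_iff_isUnit.2 hu, Matrix.mulVec_surjective_iff_isUnit.2 hu⟩
      (by rw [LinearMap.det_toLin', hA]) (by simpa using hγ) v hv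
  have : Infinite k := IsAlgClosed.instInfinite
  obtain ⟨t, ht, htn⟩ := exists_ne_zero_forall_pow_ne_one (k := k) 6
  have hsingle : ∀ {v : Fin 7 → k}, v ∈ W → ∀ i, v i ≠ 0 → Pi.single i 1 ∈ W := by
    intro v hv i hi
    refine Submodule.single_mem_of_mul_mem (gammaTorus_injective ht htn) (fun w hw => ?_) hv hi
    convert hM _ (det_diagonal_gammaTorus ht) (gammaStd_gammaTorus ht) w hw using 1
    ext i
    simp [Matrix.mulVec_diagonal]
  have hmove : ∀ A : Matrix (Fin 7) (Fin 7) k, A.det = 1 →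
      (∀ u v w, gammaStd (A *ᵥ u) (A *ᵥ v) (A *ᵥ w) = gammaStd u v w) →
      ∀ i j, A j i ≠ 0 → (Pi.single i 1 : Fin 7 → k) ∈ W → (Pi.single j 1 : Fin 7 → k) ∈ W := by
    intro A hA hγ i j hji hi
    exact hsingle (hM A hA hγ _ hi) j (by simpa using hji)
  have two := hmove _ det_gammaRootTwo gammaStd_gammaRootTwo
  have three := hmove _ det_gammaRootThree gammaStd_gammaRootThree
  have weyl := hmove _ det_gammaWeyl gammaStd_gammaWeyl
  have h31 := two 3 1 (by simpa [gammaRootTwo] using hchar)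
  have h10 := three 1 0 (by simp [gammaRootThree])
  have h06 := weyl 0 6 (by simp [gammaWeyl])
  have h65 := three 6 5 (by simp [gammaRootThree])
  have h53 := two 5 3 (by simp [gammaRootTwo])
  have h32 := three 3 2 (by simpa [gammaRootThree] using hchar)
  have h24 := weyl 2 4 (by simp [gammaWeyl])
  have h43 := three 4 3 (by simp [gammaRootThree])
  refine or_iff_not_imp_left.2 fun hne => ?_
  obtain ⟨v, hv, hv0⟩ := W.ne_bot_iff.1 hne
  obtain ⟨i, hi⟩ := Function.ne_iff.1 hv0
  have hi' := hsingle hv i hi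
  have h3 : (Pi.single 3 1 : Fin 7 → k) ∈ W := by
    fin_cases i
    exacts [h53 (h65 (h06 hi')), h53 (h65 (h06 (h10 hi'))), h43 (h24 hi'), hi', h43 hi',
      h53 hi', h53 (h65 hi')]
  have h0 := h10 (h31 h3)
  have h2 := h32 h3
  apply Submodule.eq_top_of_single_mem
  intro j
  fin_cases j
  exacts [h0, h31 h3, h2, h3, h24 h2, h65 (h06 h0), h06 h0]
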